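/- arXiv:2412.08379 — 2 statements merged into one kernel-verified Lean document; each statement's English description precedes it below -/
import Mathlib

section
/- Let 2 ≤ n ≤ N, θ_n ∈ [0,1/2], and α ∈ (0,1). Then for every 1 ≤ k ≤ n−1 one has I_{n−k}^{(α)} ≥ ((ρ_k + 1)/ρ_k) b_{n−k}^{(α)}. -/
open Real MeasureTheory

/-- Graded mesh point `t_j = T (j/N)^r`. -/
noncomputable def gridT (T r : ℝ) (N j : ℕ) : ℝ := T * ((j : ℝ) / (N : ℝ)) ^ r

/-- Step size `τ_j = t_j - t_{j-1}`. -/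
noncomputable def gridTau (T r : ℝ) (N j : ℕ) : ℝ := gridT T r N j - gridT T r N (j - 1)

/-- Step-size ratio `ρ_j = τ_j / τ_{j+1}`. -/
noncomputable def gridRho (T r : ℝ) (N j : ℕ) : ℝ := gridTau T r N j / gridTau T r N (j + 1)

/-- Offset point `t_{n-θ} = θ t_{n-1} + (1-θ) t_n`. -/
noncomputable def tTheta (T r : ℝ) (N n : ℕ) (θ : ℝ) : ℝ :=
  θ * gridT T r N (n - 1) + (1 - θ) * gridT T r N n

/-- Coefficient `a_{n-k}^{(α)}`, parametrized by `k`. -/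
noncomputable def coefA (T r : ℝ) (N n : ℕ) (θ α : ℝ) (k : ℕ) : ℝ :=
  (1 / (gridTau T r N k * Real.Gamma (1 - α))) *
    ∫ s in (gridT T r N (k - 1))..(min (gridT T r N k) (tTheta T r N n θ)),
      (tTheta T r N n θ - s) ^ (-α)

/-- Coefficient `b_{n-k}^{(α)}`, parametrized by `k`. -/
noncomputable def coefB (T r : ℝ) (N n : ℕ) (θ α : ℝ) (k : ℕ) : ℝ :=
  (2 / (gridTau T r N k * (gridTau T r N k + gridTau T r N (k + 1)) * Real.Gamma (1 - α))) *
    ∫ s in (gridT T r N (k - 1))..(gridT T r N k),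
      (s - (gridT T r N (k - 1) + gridT T r N k) / 2) * (tTheta T r N n θ - s) ^ (-α)

/-- Coefficient `I_{n-k}^{(α)}`, parametrized by `k`. -/
noncomputable def coefI (T r : ℝ) (N n : ℕ) (θ α : ℝ) (k : ℕ) : ℝ :=
  (α / (Real.Gamma (1 - α) * gridTau T r N k)) *
    ∫ s in (gridT T r N (k - 1))..(gridT T r N k),
      (gridT T r N k - s) * (tTheta T r N n θ - s) ^ (-α - 1)

/-- Coefficient `J_{n-k}^{(α)}`, parametrized by `k`. -/
noncomputable def coefJ (T r : ℝ) (N n : ℕ) (θ α : ℝ) (k : ℕ) : ℝ :=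
  (α / (Real.Gamma (1 - α) * gridTau T r N k)) *
    ∫ s in (gridT T r N (k - 1))..(gridT T r N k),
      (s - gridT T r N (k - 1)) * (tTheta T r N n θ - s) ^ (-α - 1)

/-- Coefficient `c_{n-k,n}^{(α)}`, parametrized by `k` (`1 ≤ k ≤ n`). -/
noncomputable def coefC (T r : ℝ) (N n : ℕ) (θ α : ℝ) (k : ℕ) : ℝ :=
  if n = 1 then coefA T r N n θ α n
  else if k = n then coefA T r N n θ α n + gridRho T r N (n - 1) * coefB T r N n θ α (n - 1)
  else if k = 1 then coefA T r N n θ α 1 - coefB T r N n θ α 1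
  else coefA T r N n θ α k + gridRho T r N (k - 1) * coefB T r N n θ α (k - 1)
         - coefB T r N n θ α k

/-- Integration by parts against the kernel `(c - s)^(-α)`: the polynomial
`(s - a) (s - b) / 2` vanishes at both endpoints. -/
lemma integral_sub_midpoint_mul_rpow {a b c : ℝ} (α : ℝ) (hab : a ≤ b) (hbc : b < c) :
    ∫ s in a..b, (s - (a + b) / 2) * (c - s) ^ (-α) =
      α / 2 * ∫ s in a..b, (s - a) * ((b - s) * (c - s) ^ (-α - 1)) := by
  have hpos : ∀ s ∈ Set.uIcc a b, c - s ≠ 0 := fun s hs => by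
    rw [Set.uIcc_of_le hab] at hs
    linarith [hs.2]
  have hu : ∀ s ∈ Set.uIcc a b,
      HasDerivAt (fun s => (s - a) * (s - b) / 2) (s - (a + b) / 2) s := fun s _ => by
    have h := (((hasDerivAt_id s).sub_const a).mul ((hasDerivAt_id s).sub_const b)).div_const 2
    refine h.congr_deriv ?_
    simp only [id]
    ring
  have hv : ∀ s ∈ Set.uIcc a b,
      HasDerivAt (fun s => (c - s) ^ (-α)) (α * (c - s) ^ (-α - 1)) s := fun s hs => by
    have h := ((hasDerivAt_id s).const_sub c).rpow_const (p := -α) (Or.inl (hpos s hs))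
    refine h.congr_deriv ?_
    simp only [id]
    ring
  have hv' : ContinuousOn (fun s => α * (c - s) ^ (-α - 1)) (Set.uIcc a b) :=
    continuousOn_const.mul
      ((continuousOn_const.sub continuousOn_id).rpow_const fun s hs => Or.inl (hpos s hs))
  have hu' : Continuous fun s : ℝ => s - (a + b) / 2 := by fun_prop
  have parts := intervalIntegral.integral_mul_deriv_eq_deriv_mul hu hv
    (hu'.intervalIntegrable _ _) hv'.intervalIntegrable
  have hrw : (fun s => (s - a) * (s - b) / 2 * (α * (c - s) ^ (-α - 1))) =
      fun s => -(α / 2) * ((s - a) * ((b - s) * (c - s) ^ (-α - 1))) := by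
    ext s
    ring
  rw [hrw, intervalIntegral.integral_const_mul] at parts
  linear_combination parts

/-- The first moment of `(c - s)^(-α)` about the midpoint of `[a, b]` is controlled by the
weighted integral of the derivative of that kernel. -/
lemma two_mul_integral_sub_midpoint_mul_rpow_le {a b c α : ℝ} (hα : 0 ≤ α) (hab : a ≤ b)
    (hbc : b < c) :
    2 * ∫ s in a..b, (s - (a + b) / 2) * (c - s) ^ (-α) ≤
      α * ((b - a) * ∫ s in a..b, (b - s) * (c - s) ^ (-α - 1)) := by
  have hcont : ContinuousOn (fun s => (b - s) * (c - s) ^ (-α - 1)) (Set.uIcc a b) := by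
    refine (continuousOn_const.sub continuousOn_id).mul
      ((continuousOn_const.sub continuousOn_id).rpow_const fun s hs => Or.inl ?_)
    rw [Set.uIcc_of_le hab] at hs
    exact (sub_pos.2 (hs.2.trans_lt hbc)).ne'
  rw [integral_sub_midpoint_mul_rpow α hab hbc, ← mul_assoc, mul_div_cancel₀ α two_ne_zero,
    ← intervalIntegral.integral_const_mul (b - a)]
  refine mul_le_mul_of_nonneg_left (intervalIntegral.integral_mono_on hab
    (((continuous_sub_right a).continuousOn.mul hcont).intervalIntegrable)
    (continuousOn_const.mul hcont).intervalIntegrable fun s hs => ?_) hα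
  have h₁ : 0 ≤ b - s := sub_nonneg.2 hs.2
  have h₂ : 0 ≤ (c - s) ^ (-α - 1) := Real.rpow_nonneg (by linarith) _
  exact mul_le_mul_of_nonneg_right (by simpa using hs.2) (mul_nonneg h₁ h₂)

lemma gridT_strictMono {T r : ℝ} {N : ℕ} (hT : 0 < T) (hr : 0 < r) (hN : 1 ≤ N) :
    StrictMono (gridT T r N) := fun i j hij => by
  have hN' : (0 : ℝ) < N := by exact_mod_cast hN
  have hij' : (i : ℝ) < j := by exact_mod_cast hij
  unfold gridT
  gcongr

lemma gridTau_pos {T r : ℝ} {N k : ℕ} (hT : 0 < T) (hr : 0 < r) (hN : 1 ≤ N) (hk : 1 ≤ k) :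
    0 < gridTau T r N k :=
  sub_pos.2 (gridT_strictMono hT hr hN (by lia))

lemma gridT_lt_tTheta {T r θ : ℝ} {N n k : ℕ} (hT : 0 < T) (hr : 0 < r) (hN : 1 ≤ N)
    (hn : 1 ≤ n) (hθ : θ < 1) (hk : k ≤ n - 1) : gridT T r N k < tTheta T r N n θ := by
  have h₁ := (gridT_strictMono hT hr hN).monotone hk
  have h₂ := gridT_strictMono hT hr hN (show n - 1 < n by lia)
  unfold tTheta
  nlinarith [mul_pos (sub_pos.2 hθ) (sub_pos.2 h₂)]

/-- For `2 ≤ n ≤ N`, `θ ∈ [0,1/2]`, `α ∈ (0,1)` and `1 ≤ k ≤ n-1`, one has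
`I_{n-k}^{(α)} ≥ ((ρ_k + 1)/ρ_k) b_{n-k}^{(α)}`. -/
theorem coefI_ge_coefB (T r : ℝ) (N n : ℕ) (θ α : ℝ)
    (hT : 0 < T) (hr : 1 ≤ r) (hN : 1 ≤ N) (hn2 : 2 ≤ n) (hnN : n ≤ N)
    (hθ0 : 0 ≤ θ) (hθ : θ ≤ 1 / 2) (hα0 : 0 < α) (hα1 : α < 1) :
    ∀ k : ℕ, 1 ≤ k → k ≤ n - 1 →
      ((gridRho T r N k + 1) / gridRho T r N k) * coefB T r N n θ α k
        ≤ coefI T r N n θ α k := by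
  intro k hk hkn
  have hr0 : 0 < r := by linarith
  have hτ : 0 < gridTau T r N k := gridTau_pos hT hr0 hN hk
  have hτ' : 0 < gridTau T r N (k + 1) := gridTau_pos hT hr0 hN (by lia)
  have hΓ : 0 < Real.Gamma (1 - α) := Real.Gamma_pos_of_pos (by linarith)
  have key := two_mul_integral_sub_midpoint_mul_rpow_le hα0.le
    (gridT_strictMono hT hr0 hN (show k - 1 < k by lia)).le
    (gridT_lt_tTheta hT hr0 hN (by lia) (by linarith) hkn : _ < tTheta T r N n θ)
  rw [← gridTau] at key
  unfold coefB coefI gridRho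
  generalize (∫ s in (gridT T r N (k - 1))..(gridT T r N k),
    (s - (gridT T r N (k - 1) + gridT T r N k) / 2) * (tTheta T r N n θ - s) ^ (-α)) = B at key ⊢
  generalize (∫ s in (gridT T r N (k - 1))..(gridT T r N k),
    (gridT T r N k - s) * (tTheta T r N n θ - s) ^ (-α - 1)) = I at key ⊢
  generalize gridTau T r N k = τ at *
  generalize gridTau T r N (k + 1) = τ' at *
  generalize Real.Gamma (1 - α) = Γ at *
  calc _ = 2 * B / (τ ^ 2 * Γ) := by field_simp
    _ ≤ α * (τ * I) / (τ ^ 2 * Γ) := by gcongr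
    _ = _ := by field_simp
end

section
/- Let 2 ≤ n ≤ N, let α_n ∈ (0,1), set θ_n = α_n/2, and let α ∈ (0,1) satisfy α ≥ α_n. Then ((1 − 2θ_n)/(1 − θ_n)) c_{0,n}^{(α)} − c_{1,n}^{(α)} > 0. -/
open Real MeasureTheory

theorem hasDerivAt_const_sub_rpow {x s α : ℝ} (hs : s < x) :
    HasDerivAt (fun s : ℝ => (x - s) ^ (-α)) (α * (x - s) ^ (-α - 1)) s := by
  have h := ((hasDerivAt_id s).const_sub x).rpow_const (p := -α)
    (Or.inl (by simpa using (sub_pos.2 hs).ne'))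
  simpa using h

theorem continuousOn_const_sub_rpow {x p q α : ℝ} (hpq : p ≤ q) (hq : q < x) :
    ContinuousOn (fun s : ℝ => (x - s) ^ (-α)) (Set.uIcc p q) := by
  rw [Set.uIcc_of_le hpq]
  exact fun s hs => (hasDerivAt_const_sub_rpow (hs.2.trans_lt hq)).continuousAt.continuousWithinAt

/-- A lower bound for the increments of `s ↦ (x - s) ^ (-α)` to the right of `p`. -/
theorem mul_sub_le_const_sub_rpow_sub {x p s q α : ℝ} (hα : 0 < α) (hps : p ≤ s) (hsq : s ≤ q)
    (hq : q < x) :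
    α * (x - p) ^ (-α - 1) * (q - s) ≤ (x - q) ^ (-α) - (x - s) ^ (-α) := by
  refine (convex_Icc p q).mul_sub_le_image_sub_of_le_deriv
    (f := fun s : ℝ => (x - s) ^ (-α)) ?_ ?_ ?_ s ⟨hps, hsq⟩ q ⟨hps.trans hsq, le_rfl⟩ hsq
  · exact fun y hy =>
      (hasDerivAt_const_sub_rpow (hy.2.trans_lt hq)).continuousAt.continuousWithinAt
  · intro y hy
    rw [interior_Icc] at hy
    exact (hasDerivAt_const_sub_rpow
      (hy.2.trans hq)).differentiableAt.differentiableWithinAt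
  · intro y hy
    rw [interior_Icc] at hy
    rw [(hasDerivAt_const_sub_rpow (hy.2.trans hq)).deriv]
    exact mul_le_mul_of_nonneg_left
      (rpow_le_rpow_of_nonpos (by linarith [hy.2]) (by linarith [hy.1]) (by linarith)) hα.le

/-- An upper bound for the increments of `s ↦ (x - s) ^ (-α)` to the left of `q`. -/
theorem const_sub_rpow_sub_le_mul_sub {x p s q α : ℝ} (hα : 0 < α) (hps : p ≤ s) (hsq : s ≤ q)
    (hq : q < x) :
    (x - s) ^ (-α) - (x - p) ^ (-α) ≤ α * (x - q) ^ (-α - 1) * (s - p) := by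
  refine (convex_Icc p q).image_sub_le_mul_sub_of_deriv_le
    (f := fun s : ℝ => (x - s) ^ (-α)) ?_ ?_ ?_ p ⟨le_rfl, hps.trans hsq⟩ s ⟨hps, hsq⟩ hps
  · exact fun y hy =>
      (hasDerivAt_const_sub_rpow (hy.2.trans_lt hq)).continuousAt.continuousWithinAt
  · intro y hy
    rw [interior_Icc] at hy
    exact (hasDerivAt_const_sub_rpow
      (hy.2.trans hq)).differentiableAt.differentiableWithinAt
  · intro y hy
    rw [interior_Icc] at hy
    rw [(hasDerivAt_const_sub_rpow (hy.2.trans hq)).deriv]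
    exact mul_le_mul_of_nonneg_left
      (rpow_le_rpow_of_nonpos (by linarith) (by linarith [hy.2]) (by linarith)) hα.le

theorem integral_const_sub_rpow_le {x p q α : ℝ} (hα : 0 < α) (hpq : p ≤ q) (hq : q < x) :
    ∫ s in p..q, (x - s) ^ (-α) ≤
      (q - p) * (x - q) ^ (-α) - α * (x - p) ^ (-α - 1) * (q - p) ^ 2 / 2 := by
  have h : ∫ s in p..q, (x - s) ^ (-α) ≤
      ∫ s in p..q, ((x - q) ^ (-α) - α * (x - p) ^ (-α - 1) * (q - s)) := by
    refine intervalIntegral.integral_mono_on hpq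
      (continuousOn_const_sub_rpow hpq hq).intervalIntegrable
      (Continuous.intervalIntegrable (by fun_prop) _ _) fun s hs => ?_
    linarith [mul_sub_le_const_sub_rpow_sub hα hs.1 hs.2 hq]
  refine h.trans_eq ?_
  rw [intervalIntegral.integral_sub (by simp) (Continuous.intervalIntegrable (by fun_prop) _ _),
    intervalIntegral.integral_const_mul, intervalIntegral.integral_sub (by simp) (by simp)]
  simp only [intervalIntegral.integral_const, integral_id, smul_eq_mul]
  ring

theorem integral_sub_const (p q c : ℝ) :
    ∫ s in p..q, (s - (p + q) / 2) * c = 0 := by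
  rw [intervalIntegral.integral_mul_const, intervalIntegral.integral_sub (by simp) (by simp)]
  simp only [intervalIntegral.integral_const, integral_id, smul_eq_mul]
  ring

theorem integral_sub_midpoint_mul_rpow_nonneg {x p q α : ℝ} (hα : 0 < α) (hpq : p ≤ q)
    (hq : q < x) :
    0 ≤ ∫ s in p..q, (s - (p + q) / 2) * (x - s) ^ (-α) := by
  rw [← integral_sub_const p q ((x - (p + q) / 2) ^ (-α))]
  refine intervalIntegral.integral_mono_on hpq (Continuous.intervalIntegrable (by fun_prop) _ _)
    (ContinuousOn.intervalIntegrable (ContinuousOn.mul (by fun_prop)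
      (continuousOn_const_sub_rpow hpq hq))) fun s hs => ?_
  rcases le_total s ((p + q) / 2) with h | h
  · exact mul_le_mul_of_nonpos_left
      (rpow_le_rpow_of_nonpos (by linarith) (by linarith) (by linarith)) (by linarith)
  · exact mul_le_mul_of_nonneg_left
      (rpow_le_rpow_of_nonpos (by linarith [hs.2]) (by linarith) (by linarith)) (by linarith)

theorem integral_sub_midpoint_mul_rpow_le {x p q α : ℝ} (hα : 0 < α) (hpq : p ≤ q)
    (hq : q < x) :
    ∫ s in p..q, (s - (p + q) / 2) * (x - s) ^ (-α) ≤
      α * (x - q) ^ (-α - 1) * (q - p) ^ 3 / 4 := by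
  set D := α * (x - q) ^ (-α - 1) with hD
  have hD0 : 0 ≤ D := mul_nonneg hα.le (rpow_nonneg (by linarith) _)
  have h : ∫ s in p..q, (s - (p + q) / 2) * (x - s) ^ (-α) ≤
      ∫ s in p..q, ((s - (p + q) / 2) * (x - (p + q) / 2) ^ (-α) + D * ((q - p) / 2) ^ 2) := by
    refine intervalIntegral.integral_mono_on hpq
      (ContinuousOn.intervalIntegrable (ContinuousOn.mul (by fun_prop)
        (continuousOn_const_sub_rpow hpq hq)))
      (Continuous.intervalIntegrable (by fun_prop) _ _) fun s hs => ?_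
    have hsq : D * (s - (p + q) / 2) ^ 2 ≤ D * ((q - p) / 2) ^ 2 :=
      mul_le_mul_of_nonneg_left (by nlinarith [hs.1, hs.2]) hD0
    rcases le_total s ((p + q) / 2) with h | h
    · have := const_sub_rpow_sub_le_mul_sub hα h (by linarith : (p + q) / 2 ≤ q) hq
      nlinarith
    · have := const_sub_rpow_sub_le_mul_sub hα h hs.2 hq
      nlinarith
  refine h.trans_eq ?_
  rw [intervalIntegral.integral_add (Continuous.intervalIntegrable (by fun_prop) _ _) (by simp),
    integral_sub_const]
  simp only [intervalIntegral.integral_const, smul_eq_mul]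
  ring

theorem integral_const_sub_rpow_self {x p α : ℝ} (hα : α < 1) :
    ∫ s in p..x, (x - s) ^ (-α) = (x - p) ^ (1 - α) / (1 - α) := by
  rw [intervalIntegral.integral_comp_sub_left (fun s : ℝ => s ^ (-α)) x,
    integral_rpow (Or.inl (by linarith)), sub_self, zero_rpow (by linarith), sub_zero,
    show -α + 1 = 1 - α by ring]

theorem gridT_lt_gridT_succ {T r : ℝ} {N : ℕ} (hT : 0 < T) (hr : 1 ≤ r) (hN : 1 ≤ N) (j : ℕ) :
    gridT T r N j < gridT T r N (j + 1) := by
  have hN' : (0 : ℝ) < N := by exact_mod_cast hN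
  unfold gridT
  refine mul_lt_mul_of_pos_left (rpow_lt_rpow (by positivity) ?_ (by linarith)) hT
  push_cast
  gcongr
  linarith

theorem gridTau_succ (T r : ℝ) (N j : ℕ) :
    gridTau T r N (j + 1) = gridT T r N (j + 1) - gridT T r N j := rfl

theorem gridTau_succ_pos {T r : ℝ} {N : ℕ} (hT : 0 < T) (hr : 1 ≤ r) (hN : 1 ≤ N) (j : ℕ) :
    0 < gridTau T r N (j + 1) :=
  sub_pos.2 (gridT_lt_gridT_succ hT hr hN j)

theorem gridTau_succ_le {T r : ℝ} {N : ℕ} (hT : 0 < T) (hr : 1 ≤ r) (j : ℕ) :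
    gridTau T r N (j + 1) ≤ gridTau T r N (j + 2) := by
  have h := (convexOn_rpow hr).2 (x := (j : ℝ) / N) (y := ((j + 2 : ℕ) : ℝ) / N)
    (Set.mem_Ici.2 (by positivity)) (Set.mem_Ici.2 (by positivity))
    (by norm_num : (0 : ℝ) ≤ 1 / 2) (by norm_num : (0 : ℝ) ≤ 1 / 2) (by norm_num)
  simp only [smul_eq_mul] at h
  have e : 1 / 2 * ((j : ℝ) / N) + 1 / 2 * (((j + 2 : ℕ) : ℝ) / N) = ((j + 1 : ℕ) : ℝ) / N := by
    push_cast; ring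
  rw [e] at h
  rw [gridTau_succ, show j + 2 = (j + 1) + 1 from rfl, gridTau_succ]
  simp only [gridT]
  rw [show j + 1 + 1 = j + 2 from rfl]
  nlinarith [mul_le_mul_of_nonneg_left h hT.le]

theorem tTheta_succ_sub (T r : ℝ) (N n : ℕ) (θ : ℝ) :
    tTheta T r N (n + 1) θ - gridT T r N n = (1 - θ) * gridTau T r N (n + 1) := by
  simp only [tTheta, gridTau_succ, Nat.add_sub_cancel]
  ring

theorem gridT_lt_tTheta_succ {T r θ : ℝ} {N : ℕ} (hT : 0 < T) (hr : 1 ≤ r) (hN : 1 ≤ N)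
    (hθ : θ < 1) (n : ℕ) : gridT T r N n < tTheta T r N (n + 1) θ := by
  have := tTheta_succ_sub T r N n θ
  have := mul_pos (sub_pos.2 hθ) (gridTau_succ_pos hT hr hN n)
  linarith

theorem coefB_nonneg {T r θ α : ℝ} {N : ℕ} (hT : 0 < T) (hr : 1 ≤ r) (hN : 1 ≤ N)
    (hα0 : 0 < α) (hα1 : α < 1) (n k : ℕ) (hk : gridT T r N (k + 1) < tTheta T r N n θ) :
    0 ≤ coefB T r N n θ α (k + 1) := by
  have h1 := gridTau_succ_pos hT hr hN k
  have h2 := gridTau_succ_pos hT hr hN (k + 1)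
  have hG := Gamma_pos_of_pos (sub_pos.2 hα1)
  exact mul_nonneg (by positivity)
    (integral_sub_midpoint_mul_rpow_nonneg hα0 (gridT_lt_gridT_succ hT hr hN k).le hk)

theorem gridRho_mul_coefB_le {T r θ α : ℝ} {N : ℕ} (hT : 0 < T) (hr : 1 ≤ r) (hN : 1 ≤ N)
    (hα0 : 0 < α) (hα1 : α < 1) (n k : ℕ) (hk : gridT T r N (k + 1) < tTheta T r N n θ) :
    gridRho T r N (k + 1) * coefB T r N n θ α (k + 1) ≤
      α * (tTheta T r N n θ - gridT T r N (k + 1)) ^ (-α - 1) * gridTau T r N (k + 2) / 4 /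
        Gamma (1 - α) := by
  have h1 := gridTau_succ_pos hT hr hN k
  have h2 : 0 < gridTau T r N (k + 2) := gridTau_succ_pos hT hr hN (k + 1)
  have h12 := gridTau_succ_le (N := N) hT hr k
  have hG := Gamma_pos_of_pos (sub_pos.2 hα1)
  have hB := integral_sub_midpoint_mul_rpow_le hα0 (gridT_lt_gridT_succ hT hr hN k).le hk
  have hD : 0 ≤ α * (tTheta T r N n θ - gridT T r N (k + 1)) ^ (-α - 1) :=
    mul_nonneg hα0.le (rpow_nonneg (by linarith) _)
  rw [← gridTau_succ] at hB
  simp only [gridRho, coefB, Nat.add_sub_cancel, show k + 1 + 1 = k + 2 from rfl]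
  set u := gridTau T r N (k + 1)
  set v := gridTau T r N (k + 2)
  set G := Gamma (1 - α)
  set D := α * (tTheta T r N n θ - gridT T r N (k + 1)) ^ (-α - 1)
  set B := ∫ s in gridT T r N k..gridT T r N (k + 1),
    (s - (gridT T r N k + gridT T r N (k + 1)) / 2) * (tTheta T r N n θ - s) ^ (-α)
  have e : u / v * (2 / (u * (u + v) * G) * B) = 2 * B / (v * (u + v)) / G := by
    field_simp
  rw [e]
  refine div_le_div_of_nonneg_right ?_ hG.le
  rw [div_le_iff₀ (by positivity)]
  have h3 : 2 * u ^ 3 ≤ v * (v * (u + v)) := by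
    nlinarith [pow_le_pow_left₀ h1.le h12 2, pow_le_pow_left₀ h1.le h12 3,
      mul_le_mul_of_nonneg_right (pow_le_pow_left₀ h1.le h12 2) h1.le]
  nlinarith [mul_le_mul_of_nonneg_left h3 hD]

theorem coefA_succ_le {T r θ α : ℝ} {N : ℕ} (hT : 0 < T) (hr : 1 ≤ r) (hN : 1 ≤ N)
    (hα0 : 0 < α) (hα1 : α < 1) (n k : ℕ) (hk : gridT T r N (k + 1) < tTheta T r N n θ) :
    coefA T r N n θ α (k + 1) ≤
      ((tTheta T r N n θ - gridT T r N (k + 1)) ^ (-α) -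
        α * (tTheta T r N n θ - gridT T r N k) ^ (-α - 1) * gridTau T r N (k + 1) / 2) /
        Gamma (1 - α) := by
  have h1 := gridTau_succ_pos hT hr hN k
  have hG := Gamma_pos_of_pos (sub_pos.2 hα1)
  have hA := integral_const_sub_rpow_le hα0 (gridT_lt_gridT_succ hT hr hN k).le hk
  rw [← gridTau_succ] at hA
  simp only [coefA, Nat.add_sub_cancel, min_eq_left hk.le]
  rw [one_div_mul_eq_div, div_le_iff₀ (by positivity)]
  refine hA.trans_eq ?_
  field_simp

/-- The lower bound for the weighted leading coefficient. -/
theorem le_mul_coefA_self {T r αn α : ℝ} {N : ℕ} (hT : 0 < T) (hr : 1 ≤ r) (hN : 1 ≤ N)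
    (hαn0 : 0 < αn) (hαn1 : αn < 1) (hα1 : α < 1) (hααn : αn ≤ α) (n : ℕ) :
    (tTheta T r N (n + 1) (αn / 2) - gridT T r N n) ^ (-α) / Gamma (1 - α) ≤
      (1 - 2 * (αn / 2)) / (1 - αn / 2) * coefA T r N (n + 1) (αn / 2) α (n + 1) := by
  have h1 := gridTau_succ_pos hT hr hN n
  have hG := Gamma_pos_of_pos (sub_pos.2 hα1)
  have hs := tTheta_succ_sub T r N n (αn / 2)
  have hx := gridT_lt_tTheta_succ hT hr hN (by linarith : αn / 2 < 1) n
  have hmin : tTheta T r N (n + 1) (αn / 2) ≤ gridT T r N (n + 1) := by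
    rw [gridTau_succ] at hs h1
    nlinarith
  simp only [coefA, Nat.add_sub_cancel, min_eq_right hmin]
  rw [integral_const_sub_rpow_self hα1, show 1 - α = -α + 1 by ring,
    rpow_add_one (sub_pos.2 hx).ne', show -α + 1 = 1 - α by ring]
  have hg := rpow_pos_of_pos (sub_pos.2 hx) (-α)
  set g := (tTheta T r N (n + 1) (αn / 2) - gridT T r N n) ^ (-α)
  rw [hs]
  have hσ : 0 < 1 - αn / 2 := by linarith
  have hα : 0 < 1 - α := by linarith
  have e : (1 - 2 * (αn / 2)) / (1 - αn / 2) * (1 / (gridTau T r N (n + 1) * Gamma (1 - α)) *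
      (g * ((1 - αn / 2) * gridTau T r N (n + 1)) / (1 - α))) =
      g * ((1 - αn) / (1 - α)) / Gamma (1 - α) := by
    rw [show 2 * (αn / 2) = αn by ring]
    generalize 1 - αn / 2 = σ at hσ
    field_simp
  rw [e]
  gcongr
  exact le_mul_of_one_le_right hg.le ((one_le_div hα).2 (by linarith))

/-- For `2 ≤ n ≤ N`, `α_n ∈ (0,1)`, `θ_n = α_n/2` and `α ∈ (0,1)` with `α ≥ α_n`:
`((1-2θ_n)/(1-θ_n)) c_{0,n}^{(α)} - c_{1,n}^{(α)} > 0`. -/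
theorem coefC_zero_one_ineq (T r : ℝ) (N n : ℕ) (αn α : ℝ)
    (hT : 0 < T) (hr : 1 ≤ r) (hN : 1 ≤ N) (hn2 : 2 ≤ n) (hnN : n ≤ N)
    (hαn0 : 0 < αn) (hαn1 : αn < 1) (hα0 : 0 < α) (hα1 : α < 1) (hααn : αn ≤ α) :
    0 < ((1 - 2 * (αn / 2)) / (1 - αn / 2)) * coefC T r N n (αn / 2) α n
          - coefC T r N n (αn / 2) α (n - 1) := by
  obtain ⟨m, rfl⟩ : ∃ m, n = m + 2 := ⟨n - 2, by omega⟩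
  have hG := Gamma_pos_of_pos (sub_pos.2 hα1)
  have hx := gridT_lt_tTheta_succ hT hr hN (by linarith : αn / 2 < 1) (m + 1)
  have h1 := gridTau_succ_pos hT hr hN m
  have h2 := gridTau_succ_pos hT hr hN (m + 1)
  have hg := gridT_lt_gridT_succ hT hr hN m
  have hx' := hg.trans hx
  have hA0 := le_mul_coefA_self hT hr hN hαn0 hαn1 hα1 hααn (m + 1)
  have hA1 := coefA_succ_le hT hr hN hα0 hα1 (m + 1 + 1) m hx
  have hB1 := coefB_nonneg hT hr hN hα0 hα1 (m + 1 + 1) m hx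
  have hl : 0 ≤ (1 - 2 * (αn / 2)) / (1 - αn / 2) := div_nonneg (by linarith) (by linarith)
  have hρ : 0 ≤ gridRho T r N (m + 1) := div_nonneg h1.le h2.le
  have hρB := mul_nonneg hl (mul_nonneg hρ hB1)
  have hD : 0 < α * (tTheta T r N (m + 1 + 1) (αn / 2) - gridT T r N m) ^ (-α - 1) *
      gridTau T r N (m + 1) / Gamma (1 - α) := by
    have := rpow_pos_of_pos (sub_pos.2 hx') (-α - 1)
    positivity
  rw [sub_div, div_right_comm _ (2 : ℝ)] at hA1
  have hc0 : coefC T r N (m + 2) (αn / 2) α (m + 2) = coefA T r N (m + 2) (αn / 2) α (m + 2) +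
      gridRho T r N (m + 1) * coefB T r N (m + 2) (αn / 2) α (m + 1) := by
    simp [coefC]
  rw [hc0, mul_add, show m + 2 - 1 = m + 1 by omega]
  rcases m with _ | k
  · have hc1 : coefC T r N (0 + 2) (αn / 2) α (0 + 1) =
        coefA T r N (0 + 2) (αn / 2) α (0 + 1) - coefB T r N (0 + 2) (αn / 2) α (0 + 1) := by
      simp [coefC]
    rw [hc1]
    linarith
  · have hB2 := gridRho_mul_coefB_le hT hr hN hα0 hα1 (k + 1 + 1 + 1) k hx'
    rw [div_right_comm _ (4 : ℝ)] at hB2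
    have hc1 : coefC T r N (k + 1 + 2) (αn / 2) α (k + 1 + 1) =
        coefA T r N (k + 1 + 2) (αn / 2) α (k + 1 + 1) +
          gridRho T r N (k + 1) * coefB T r N (k + 1 + 2) (αn / 2) α (k + 1) -
          coefB T r N (k + 1 + 2) (αn / 2) α (k + 1 + 1) := by
      simp [coefC]
    rw [hc1]
    linarith
end
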